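/- arXiv:2409.15880 — 2 statements merged into one kernel-verified Lean document; each statement's English description precedes it below -/
import Mathlib

section
/- Suppose the finite set 𝒦 yields a grid for the countable group G acting on (W, λ) by negligibility-preserving homeomorphisms. Then for λ-almost every point 0 ∈ W there exists a unique pair (g₀, K₀) ∈ G×𝒦 with 0 ∈ g₀·K₀. Moreover, if T is a poly-𝒦 tile, then for λ-almost every 0 ∈ W (with (g₀,K₀) the unique such pair) one has grp(T) = {h ∈ G : λ(h·g₀·K₀ ∩ T) > 0}; in particular, choosing for each K ∈ 𝒦 such a generic point 0_K ∈ K, T = ⊔_{K∈𝒦} ⋃_{h ∈ grp_{0_K}(T)} h·K up to a λ-null set, where grp_{0_K}(T) = {h ∈ G : h·0_K ∈ T}. -/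
open scoped Pointwise
open MeasureTheory

/-- A translate of a null set by a negligibility-preserving action is null. -/
theorem measure_smul_null_of_preserves_pos {W G : Type*} [MeasurableSpace W] [Group G]
    [MulAction G W] {μ : Measure W}
    (hneg : ∀ (g : G) (A : Set W), 0 < μ A → 0 < μ (g • A)) (g : G) {A : Set W}
    (hA : μ A = 0) : μ (g • A) = 0 := by
  by_contra h
  have := hneg g⁻¹ (g • A) (pos_iff_ne_zero.mpr h)
  rw [inv_smul_smul] at this
  exact this.ne' hA

/-- If `N` is null, then the whole orbit of almost every point avoids `N`. -/
theorem ae_forall_smul_notMem_of_null {W G : Type*} [MeasurableSpace W] [Group G] [Countable G]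
    [MulAction G W] {μ : Measure W}
    (hneg : ∀ (g : G) (A : Set W), 0 < μ A → 0 < μ (g • A)) {N : Set W} (hN : μ N = 0) :
    ∀ᵐ z ∂μ, ∀ h : G, h • z ∉ N := by
  refine ae_all_iff.mpr fun h => ?_
  refine measure_mono_null ?_ (measure_smul_null_of_preserves_pos hneg h⁻¹ hN)
  intro z hz
  rw [Set.mem_inv_smul_set_iff]
  simpa using hz

/-- The points lying in two different translates of a grid form a null set. -/
theorem measure_iUnion_overlap_null {W G : Type*} [MeasurableSpace W] [Group G] [Countable G]
    [MulAction G W] {μ : Measure W} {𝒦 : Set (Set W)} (h𝒦 : 𝒦.Countable)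
    (hdisj : ∀ p : G × Set W, p.2 ∈ 𝒦 → ∀ q : G × Set W, q.2 ∈ 𝒦 → p ≠ q →
      μ (p.1 • p.2 ∩ q.1 • q.2) = 0) :
    μ {z | ∃ p q : G × Set W, p.2 ∈ 𝒦 ∧ q.2 ∈ 𝒦 ∧ p ≠ q ∧ z ∈ p.1 • p.2 ∩ q.1 • q.2} = 0 := by
  have hc : ((Set.univ : Set G) ×ˢ 𝒦).Countable := Set.countable_univ.prod h𝒦
  have h0 : μ (⋃ p ∈ (Set.univ : Set G) ×ˢ 𝒦, ⋃ q ∈ (Set.univ : Set G) ×ˢ 𝒦,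
      {z | p ≠ q ∧ z ∈ p.1 • p.2 ∩ q.1 • q.2}) = 0 := by
    refine (measure_biUnion_null_iff hc).mpr fun p hp =>
      (measure_biUnion_null_iff hc).mpr fun q hq => ?_
    by_cases hpq : p = q
    · simp [hpq]
    · exact measure_mono_null (fun z hz => hz.2) (hdisj p hp.2 q hq.2 hpq)
  refine measure_mono_null ?_ h0
  rintro z ⟨p, q, hp, hq, hpq, hz⟩
  simp only [Set.mem_iUnion]
  exact ⟨p, ⟨trivial, hp⟩, q, ⟨trivial, hq⟩, hpq, hz⟩

/-- A translate of a grid tile meets a tiled set in positive measure exactly when it is one of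
the translates that tile the set. -/
theorem measure_smul_inter_pos_iff {W G : Type*} [MeasurableSpace W] [Group G]
    [MulAction G W] {μ : Measure W}
    (hneg : ∀ (g : G) (A : Set W), 0 < μ A → 0 < μ (g • A))
    {𝒦 : Set (Set W)} (hpos : ∀ K ∈ 𝒦, 0 < μ K)
    (hdisj : ∀ p : G × Set W, p.2 ∈ 𝒦 → ∀ q : G × Set W, q.2 ∈ 𝒦 → p ≠ q →
      μ (p.1 • p.2 ∩ q.1 • q.2) = 0)
    {T : Set W} {D : Set (G × Set W)} (hD : D.Countable) (hDK : D ⊆ (Set.univ : Set G) ×ˢ 𝒦)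
    (hT : μ (symmDiff T (⋃ p ∈ D, p.1 • p.2)) = 0) (h : G) {K : Set W} (hK : K ∈ 𝒦) :
    0 < μ ((h • K) ∩ T) ↔ (h, K) ∈ D := by
  constructor
  · intro hlt
    by_contra hmem
    refine hlt.ne' ?_
    have h1 : μ (⋃ p ∈ D, (h • K ∩ p.1 • p.2)) = 0 := by
      refine (measure_biUnion_null_iff hD).mpr fun p hp => ?_
      exact hdisj (h, K) hK p (hDK hp).2 fun e => hmem (e ▸ hp)
    refine measure_mono_null ?_ (measure_union_null hT h1)
    rintro z ⟨hzK, hzT⟩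
    by_cases hz : z ∈ ⋃ p ∈ D, p.1 • p.2
    · right
      simp only [Set.mem_iUnion] at hz ⊢
      obtain ⟨p, hp, hz⟩ := hz
      exact ⟨p, hp, hzK, hz⟩
    · exact Or.inl (Or.inl ⟨hzT, hz⟩)
  · intro hmem
    refine pos_iff_ne_zero.mpr fun h0 => ?_
    refine (hneg h K (hpos K hK)).ne' ?_
    refine measure_mono_null ?_ (measure_union_null hT h0)
    intro z hz
    by_cases hzT : z ∈ T
    · exact Or.inr ⟨hz, hzT⟩
    · exact Or.inl (Or.inr ⟨Set.mem_biUnion hmem hz, hzT⟩)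

theorem statement_15 {W : Type*} [TopologicalSpace W] [MeasurableSpace W] [BorelSpace W]
    {G : Type*} [Group G] [Countable G] [MulAction G W]
    (hcont : ∀ g : G, Continuous fun x : W => g • x)
    (μ : Measure W) (hμ : μ ≠ 0)
    (hneg : ∀ (g : G) (A : Set W), 0 < μ A → 0 < μ (g • A))
    -- `𝒦` is a finite set of tiles yielding a grid:
    (𝒦 : Set (Set W)) (h𝒦fin : 𝒦.Finite)
    (h𝒦tile : ∀ K ∈ 𝒦, MeasurableSet K ∧ 0 < μ K)
    (hgriddisj : ∀ p : G × Set W, p.2 ∈ 𝒦 → ∀ q : G × Set W, q.2 ∈ 𝒦 → p ≠ q →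
      μ (p.1 • p.2 ∩ q.1 • q.2) = 0)
    (hgridcover : μ ((⋃ p ∈ (Set.univ : Set G) ×ˢ 𝒦, p.1 • p.2)ᶜ) = 0) :
    -- (a) for a.e. `z` there is a unique `(g₀,K₀) ∈ G × 𝒦` whose translate contains `z`:
    (∀ᵐ z ∂μ, ∃! p : G × Set W, p.2 ∈ 𝒦 ∧ z ∈ p.1 • p.2) ∧
    -- (b) if `T` is a poly-`𝒦` tile then for a.e. `z`, for the pairs `(g₀,K₀)` with
    -- `z ∈ g₀ • K₀`, one has `grp_z(T) = {h : 0 < μ(h • g₀ • K₀ ∩ T)} = grp_{g₀•K₀}(T)`: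
    (∀ (T : Set W) (D : Set (G × Set W)), D.Finite → D ⊆ (Set.univ : Set G) ×ˢ 𝒦 →
      μ (symmDiff T (⋃ p ∈ D, p.1 • p.2)) = 0 →
      ((∀ᵐ z ∂μ, ∀ (g₀ : G), ∀ K₀ ∈ 𝒦, z ∈ g₀ • K₀ →
          {h : G | h • z ∈ T} = {h : G | 0 < μ ((h • g₀ • K₀) ∩ T)}) ∧
        -- (c) choosing a generic point `0_K ∈ K` for each `K ∈ 𝒦`,
        -- `T = ⊔_{K ∈ 𝒦} grp_{0_K}(T) • K` up to a `μ`-null set: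
        (∀ o : Set W → W,
          (∀ K ∈ 𝒦, o K ∈ K ∧
            {h : G | h • o K ∈ T} = {h : G | 0 < μ ((h • K) ∩ T)}) →
          μ (symmDiff T (⋃ K ∈ 𝒦, ⋃ h ∈ {h : G | h • o K ∈ T}, h • K)) = 0))) := by
  have hover := measure_iUnion_overlap_null h𝒦fin.countable hgriddisj
  refine ⟨?_, fun T D hDfin hDK hT => ?_⟩
  · have hcover : ∀ᵐ z ∂μ, z ∈ ⋃ p ∈ (Set.univ : Set G) ×ˢ 𝒦, p.1 • p.2 := hgridcover
    filter_upwards [hcover, measure_eq_zero_iff_ae_notMem.mp hover] with z hz hz'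
    simp only [Set.mem_iUnion] at hz
    obtain ⟨p, hp, hzp⟩ := hz
    refine ⟨p, ⟨hp.2, hzp⟩, fun q hq => ?_⟩
    by_contra hne
    exact hz' ⟨q, p, hq.1, hp.2, hne, hq.2, hzp⟩
  have key := fun (h : G) {K : Set W} (hK : K ∈ 𝒦) =>
    measure_smul_inter_pos_iff hneg (fun K hK => (h𝒦tile K hK).2) hgriddisj hDfin.countable
      hDK hT h hK
  constructor
  · filter_upwards [ae_forall_smul_notMem_of_null hneg hT,
      ae_forall_smul_notMem_of_null hneg hover] with z hzT hzO g₀ K₀ hK₀ hz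
    ext h
    have hhz : h • z ∈ (h * g₀) • K₀ := by
      rw [mul_smul]
      exact Set.smul_mem_smul_set hz
    rw [Set.mem_ofPred_eq, Set.mem_ofPred_eq, ← mul_smul, key (h * g₀) hK₀]
    constructor
    · intro hT'
      have hU : h • z ∈ ⋃ p ∈ D, p.1 • p.2 := by
        by_contra hU
        exact hzT h (Or.inl ⟨hT', hU⟩)
      simp only [Set.mem_iUnion] at hU
      obtain ⟨p, hp, hzp⟩ := hU
      by_contra hne
      exact hzO h ⟨p, (h * g₀, K₀), (hDK hp).2, hK₀, fun e => hne (e ▸ hp), hzp, hhz⟩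
    · intro hmem
      by_contra hT'
      exact hzT h (Or.inr ⟨Set.mem_biUnion hmem hhz, hT'⟩)
  · intro o ho
    have hU : (⋃ K ∈ 𝒦, ⋃ h ∈ {h : G | h • o K ∈ T}, h • K) = ⋃ p ∈ D, p.1 • p.2 := by
      ext z
      simp only [Set.mem_iUnion]
      constructor
      · rintro ⟨K, hK, h, hh, hz⟩
        rw [(ho K hK).2] at hh
        exact ⟨(h, K), (key h hK).mp hh, hz⟩
      · rintro ⟨⟨h, K⟩, hp, hz⟩
        have hK : K ∈ 𝒦 := (hDK hp).2
        refine ⟨K, hK, h, ?_, hz⟩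
        rw [(ho K hK).2]
        exact (key h hK).mpr hp
    rw [hU]
    exact hT
end

section
/- In Isom(ℝ²), let R6 be the rotation by π/3 about (0,0), R3 the rotation by 2π/3 about (2,0), and β the reflection across the x-axis. Then: (i) the Kite K (the convex quadrilateral with vertices (0,0), (3/2,√3/2), (2,0), (3/2,−√3/2)) is a fundamental domain up to Lebesgue-null sets for the subgroup Γ⁺ := ⟨R6, R3⟩ of Isom(ℝ²), i.e. ℝ² = ⊔_{g ∈ Γ⁺} g·K up to Lebesgue-null sets; and (ii) the Semikite K₊ (the triangle with vertices (0,0), (2,0), (3/2,√3/2)) is a fundamental domain up to Lebesgue-null sets for the subgroup Γ := ⟨R6, R3, β⟩, i.e. ℝ² = ⊔_{g ∈ Γ} g·K₊ up to Lebesgue-null sets. -/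
open MeasureTheory Complex

noncomputable section

/-- The group of isometries of the euclidean plane, identified with `ℂ`. -/
abbrev IsomC := ℂ ≃ᵢ ℂ

/-- The rotation of angle `θ` about the point `c`. -/
noncomputable def rotAbout (θ : ℝ) (c : ℂ) : IsomC :=
  (IsometryEquiv.addLeft (-c)).trans
    ((rotation (Circle.exp θ)).toIsometryEquiv.trans (IsometryEquiv.addLeft c))

/-- `R6`: rotation by `π/3` about the origin. -/
noncomputable def R6 : IsomC := rotAbout (Real.pi / 3) 0
/-- `R3`: rotation by `2π/3` about `(2,0)`. -/
noncomputable def R3 : IsomC := rotAbout (2 * Real.pi / 3) 2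
/-- `β`: the reflection across the x-axis, i.e. complex conjugation. -/
noncomputable def reflX : IsomC := Complex.conjLIE.toIsometryEquiv

/-- The Kite: convex quadrilateral with vertices `(0,0)`, `(3/2,√3/2)`, `(2,0)`,
`(3/2,−√3/2)`. -/
def Kite : Set ℂ :=
  convexHull ℝ {0, ⟨3 / 2, Real.sqrt 3 / 2⟩, 2, ⟨3 / 2, -(Real.sqrt 3 / 2)⟩}

/-- The Semikite: the triangle with vertices `(0,0)`, `(2,0)`, `(3/2,√3/2)`. -/
def Semikite : Set ℂ :=
  convexHull ℝ {0, 2, ⟨3 / 2, Real.sqrt 3 / 2⟩}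

/-- `Γ⁺ = ⟨R6, R3⟩`. -/
noncomputable def Γplus : Subgroup IsomC := Subgroup.closure {R6, R3}

/-- `Γ = ⟨R6, R3, β⟩`. -/
noncomputable def Γfull : Subgroup IsomC := Subgroup.closure {R6, R3, reflX}

/-- The first coordinate in the basis `3 + i√3`, `3 - i√3` of the translation lattice of `Γ⁺`. -/
def coordA : ℂ →L[ℝ] ℝ := (1 / 6 : ℝ) • reCLM + (Real.sqrt 3 / 6) • imCLM

/-- The second coordinate in the basis `3 + i√3`, `3 - i√3` of the translation lattice of `Γ⁺`. -/
def coordB : ℂ →L[ℝ] ℝ := (1 / 6 : ℝ) • reCLM - (Real.sqrt 3 / 6) • imCLM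

lemma coordA_apply (z : ℂ) : coordA z = z.re / 6 + Real.sqrt 3 / 6 * z.im := by
  simp [coordA]; ring

lemma coordB_apply (z : ℂ) : coordB z = z.re / 6 - Real.sqrt 3 / 6 * z.im := by
  simp [coordB]; ring

lemma sqrt_three_mul_self : Real.sqrt 3 * Real.sqrt 3 = 3 := Real.mul_self_sqrt (by norm_num)

lemma re_eq_coord (z : ℂ) : z.re = 3 * (coordA z + coordB z) := by
  rw [coordA_apply, coordB_apply]; ring

lemma im_eq_coord (z : ℂ) : z.im = Real.sqrt 3 * (coordA z - coordB z) := by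
  rw [coordA_apply, coordB_apply]; linear_combination (-z.im / 3) * sqrt_three_mul_self

lemma ext_coord {z w : ℂ} (hA : coordA z = coordA w) (hB : coordB z = coordB w) : z = w := by
  apply Complex.ext
  · rw [re_eq_coord, re_eq_coord w, hA, hB]
  · rw [im_eq_coord, im_eq_coord w, hA, hB]

/-! ### The generators in lattice coordinates -/

lemma rotAbout_apply (θ : ℝ) (c z : ℂ) :
    rotAbout θ c z = c + (Real.cos θ + Real.sin θ * I) * (-c + z) := by
  simp [rotAbout, Circle.coe_exp, Complex.exp_mul_I]

lemma cos_two_pi_div_three : Real.cos (2 * Real.pi / 3) = -(1 / 2) := by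
  rw [show 2 * Real.pi / 3 = Real.pi - Real.pi / 3 by ring, Real.cos_pi_sub, Real.cos_pi_div_three]

lemma sin_two_pi_div_three : Real.sin (2 * Real.pi / 3) = Real.sqrt 3 / 2 := by
  rw [show 2 * Real.pi / 3 = Real.pi - Real.pi / 3 by ring, Real.sin_pi_sub, Real.sin_pi_div_three]

lemma re_rotAbout (θ : ℝ) (c z : ℂ) : (rotAbout θ c z).re =
    c.re + (Real.cos θ * (z.re - c.re) - Real.sin θ * (z.im - c.im)) := by
  rw [rotAbout_apply]
  simp [-ofReal_cos, -ofReal_sin]; ring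

lemma im_rotAbout (θ : ℝ) (c z : ℂ) : (rotAbout θ c z).im =
    c.im + (Real.cos θ * (z.im - c.im) + Real.sin θ * (z.re - c.re)) := by
  rw [rotAbout_apply]
  simp [-ofReal_cos, -ofReal_sin]; ring

lemma coordA_R6 (z : ℂ) : coordA (R6 z) = coordA z + coordB z := by
  simp only [coordA_apply, coordB_apply, R6, re_rotAbout, im_rotAbout, Real.cos_pi_div_three,
    Real.sin_pi_div_three, zero_re, zero_im]
  linear_combination (z.re / 12) * sqrt_three_mul_self

lemma coordB_R6 (z : ℂ) : coordB (R6 z) = -coordA z := by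
  simp only [coordA_apply, coordB_apply, R6, re_rotAbout, im_rotAbout, Real.cos_pi_div_three,
    Real.sin_pi_div_three, zero_re, zero_im]
  linear_combination (-z.re / 12) * sqrt_three_mul_self

lemma coordA_R3 (z : ℂ) : coordA (R3 z) = coordB z := by
  simp only [coordA_apply, coordB_apply, R3, re_rotAbout, im_rotAbout, cos_two_pi_div_three,
    sin_two_pi_div_three, re_ofNat, im_ofNat]
  linear_combination ((z.re - 2) / 12) * sqrt_three_mul_self

lemma coordB_R3 (z : ℂ) : coordB (R3 z) = 1 - coordA z - coordB z := by
  simp only [coordA_apply, coordB_apply, R3, re_rotAbout, im_rotAbout, cos_two_pi_div_three,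
    sin_two_pi_div_three, re_ofNat, im_ofNat]
  linear_combination (-(z.re - 2) / 12) * sqrt_three_mul_self

lemma coordA_reflX (z : ℂ) : coordA (reflX z) = coordB z := by
  simp [coordA_apply, coordB_apply, reflX]; ring

lemma coordB_reflX (z : ℂ) : coordB (reflX z) = coordA z := by
  simp [coordA_apply, coordB_apply, reflX]

lemma coordA_R6_inv (z : ℂ) : coordA (R6⁻¹ z) = -coordB z := by
  have h := coordB_R6 (R6⁻¹ z)
  rw [IsometryEquiv.apply_inv_self] at h
  linarith

lemma coordB_R6_inv (z : ℂ) : coordB (R6⁻¹ z) = coordA z + coordB z := by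
  have h := coordA_R6 (R6⁻¹ z)
  rw [IsometryEquiv.apply_inv_self, coordA_R6_inv] at h
  linarith

lemma coordB_R3_inv (z : ℂ) : coordB (R3⁻¹ z) = coordA z := by
  have h := coordA_R3 (R3⁻¹ z)
  rw [IsometryEquiv.apply_inv_self] at h
  exact h.symm

lemma coordA_R3_inv (z : ℂ) : coordA (R3⁻¹ z) = 1 - coordA z - coordB z := by
  have h := coordB_R3 (R3⁻¹ z)
  rw [IsometryEquiv.apply_inv_self, coordB_R3_inv] at h
  linarith

lemma reflX_inv : reflX⁻¹ = reflX := by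
  rw [inv_eq_iff_mul_eq_one]
  ext z
  simp [reflX, IsometryEquiv.mul_apply]

/-! ### Membership in the tiles -/

lemma add_add_mem_convexHull {x y w : ℂ} {a b c : ℝ} (ha : 0 ≤ a) (hb : 0 ≤ b) (hc : 0 ≤ c)
    (habc : a + b + c = 1) : a • x + b • y + c • w ∈ convexHull ℝ {x, y, w} := by
  have h := (convex_convexHull ℝ {x, y, w}).sum_mem (t := Finset.univ) (w := ![a, b, c])
    (z := ![x, y, w]) (by simp [Fin.forall_fin_succ, ha, hb, hc])
    (by simp [Fin.sum_univ_three, habc])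
    (fun i _ => subset_convexHull ℝ _ (by fin_cases i <;> simp))
  simpa [Fin.sum_univ_three] using h

lemma mem_Semikite_of_coord {z : ℂ} (h₀ : 0 ≤ coordB z) (h₁ : coordB z ≤ coordA z)
    (h₂ : 2 * coordA z + coordB z ≤ 1) : z ∈ Semikite := by
  have h := add_add_mem_convexHull (x := 0) (y := 2) (w := ⟨3 / 2, Real.sqrt 3 / 2⟩)
    (a := 1 - 2 * coordA z - coordB z) (b := 3 * coordB z) (c := 2 * (coordA z - coordB z))
    (by linarith) (by linarith) (by linarith) (by ring)
  rw [Semikite]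
  convert h using 1
  apply Complex.ext
  · rw [re_eq_coord]; simp; ring
  · rw [im_eq_coord]; simp; ring

lemma mem_Kite_of_coord {z : ℂ} (hA : 0 ≤ coordA z) (hB : 0 ≤ coordB z)
    (h₁ : 2 * coordA z + coordB z ≤ 1) (h₂ : coordA z + 2 * coordB z ≤ 1) : z ∈ Kite := by
  rcases le_total (coordB z) (coordA z) with hle | hle
  · refine convexHull_mono ?_ (mem_Semikite_of_coord hB hle h₁)
    rintro w (rfl | rfl | rfl) <;> simp
  · have h := add_add_mem_convexHull (x := 0) (y := 2) (w := ⟨3 / 2, -(Real.sqrt 3 / 2)⟩)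
      (a := 1 - coordA z - 2 * coordB z) (b := 3 * coordA z) (c := 2 * (coordB z - coordA z))
      (by linarith) (by linarith) (by linarith) (by ring)
    have hz : z ∈ convexHull ℝ {0, 2, ⟨3 / 2, -(Real.sqrt 3 / 2)⟩} := by
      convert h using 1
      apply Complex.ext
      · rw [re_eq_coord]; simp; ring
      · rw [im_eq_coord]; simp; ring
    refine convexHull_mono ?_ hz
    rintro w (rfl | rfl | rfl) <;> simp

lemma convex_setOf_le (f : ℂ →L[ℝ] ℝ) (c : ℝ) : Convex ℝ {z | f z ≤ c} :=
  convex_halfSpace_le f.toLinearMap.isLinear c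

lemma Semikite_subset : Semikite ⊆
    {z | (-coordB) z ≤ 0} ∩ {z | (coordB - coordA) z ≤ 0} ∩
      {z | ((2 : ℝ) • coordA + coordB) z ≤ 1} := by
  refine convexHull_min ?_ (((convex_setOf_le _ _).inter (convex_setOf_le _ _)).inter
    (convex_setOf_le _ _))
  have := sqrt_three_mul_self
  rintro z (rfl | rfl | rfl) <;>
    simp [coordA_apply, coordB_apply] <;> grind

lemma Kite_subset : Kite ⊆
    {z | (-coordA) z ≤ 0} ∩ {z | (-coordB) z ≤ 0} ∩
      ({z | ((2 : ℝ) • coordA + coordB) z ≤ 1} ∩ {z | (coordA + (2 : ℝ) • coordB) z ≤ 1}) := by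
  refine convexHull_min ?_ (((convex_setOf_le _ _).inter (convex_setOf_le _ _)).inter
    ((convex_setOf_le _ _).inter (convex_setOf_le _ _)))
  have := sqrt_three_mul_self
  rintro z (rfl | rfl | rfl | rfl) <;>
    simp [coordA_apply, coordB_apply] <;> grind

lemma lt_of_mem_interior {f : ℂ →L[ℝ] ℝ} (hf : f ≠ 0) {s : Set ℂ} {c : ℝ}
    (hs : s ⊆ {z | f z ≤ c}) {z : ℂ} (hz : z ∈ interior s) : f z < c := by
  have h := (f.isOpenMap_of_ne_zero hf).image_interior_subset s ⟨z, hz, rfl⟩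
  have h' : f '' s ⊆ Set.Iic c := Set.image_subset_iff.2 hs
  simpa using interior_mono h' h

lemma ne_zero_of_apply_eq_one {f : ℂ →L[ℝ] ℝ} {z : ℂ} (h : f z = 1) : f ≠ 0 := by
  rintro rfl
  simp at h

lemma neg_coordA_ne_zero : -coordA ≠ 0 :=
  ne_zero_of_apply_eq_one (z := -6) (by simp [coordA_apply])

lemma neg_coordB_ne_zero : -coordB ≠ 0 :=
  ne_zero_of_apply_eq_one (z := -6) (by simp [coordB_apply])

lemma coordB_sub_coordA_ne_zero : coordB - coordA ≠ 0 :=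
  ne_zero_of_apply_eq_one (z := ⟨0, -Real.sqrt 3⟩) (by
    simp [coordA_apply, coordB_apply]; linarith [sqrt_three_mul_self])

lemma two_smul_coordA_add_coordB_ne_zero : (2 : ℝ) • coordA + coordB ≠ 0 :=
  ne_zero_of_apply_eq_one (z := 2) (by norm_num [coordA_apply, coordB_apply])

lemma coordA_add_two_smul_coordB_ne_zero : coordA + (2 : ℝ) • coordB ≠ 0 :=
  ne_zero_of_apply_eq_one (z := 2) (by norm_num [coordA_apply, coordB_apply])

lemma coord_of_mem_interior_Semikite {z : ℂ} (hz : z ∈ interior Semikite) :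
    0 < coordB z ∧ coordB z < coordA z ∧ 2 * coordA z + coordB z < 1 := by
  have h₁ := lt_of_mem_interior neg_coordB_ne_zero (fun w hw => (Semikite_subset hw).1.1) hz
  have h₂ := lt_of_mem_interior coordB_sub_coordA_ne_zero
    (fun w hw => (Semikite_subset hw).1.2) hz
  have h₃ := lt_of_mem_interior two_smul_coordA_add_coordB_ne_zero
    (fun w hw => (Semikite_subset hw).2) hz
  simp at h₁ h₂ h₃
  exact ⟨h₁, h₂, h₃⟩

lemma coord_of_mem_interior_Kite {z : ℂ} (hz : z ∈ interior Kite) :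
    0 < coordA z ∧ 0 < coordB z ∧ 2 * coordA z + coordB z < 1 ∧ coordA z + 2 * coordB z < 1 := by
  have h₁ := lt_of_mem_interior neg_coordA_ne_zero (fun w hw => (Kite_subset hw).1.1) hz
  have h₂ := lt_of_mem_interior neg_coordB_ne_zero (fun w hw => (Kite_subset hw).1.2) hz
  have h₃ := lt_of_mem_interior two_smul_coordA_add_coordB_ne_zero
    (fun w hw => (Kite_subset hw).2.1) hz
  have h₄ := lt_of_mem_interior coordA_add_two_smul_coordB_ne_zero
    (fun w hw => (Kite_subset hw).2.2) hz
  simp at h₁ h₂ h₃ h₄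
  exact ⟨h₁, h₂, h₃, h₄⟩

/-! ### The groups act by integral affine maps in lattice coordinates -/

/-- In lattice coordinates, `g` has linear part with rows `(M.1, M.2.1)` and `(M.2.2.1, M.2.2.2)`
and an integral translation part. -/
def HasLinearPart (g : IsomC) (M : ℤ × ℤ × ℤ × ℤ) : Prop :=
  ∃ m n : ℤ, ∀ z, coordA (g z) = M.1 * coordA z + M.2.1 * coordB z + m ∧
    coordB (g z) = M.2.2.1 * coordA z + M.2.2.2 * coordB z + n

/-- The linear parts of the elements of `Γ⁺`. -/
def rotationParts : List (ℤ × ℤ × ℤ × ℤ) :=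
  [(1, 0, 0, 1), (1, 1, -1, 0), (0, 1, -1, -1), (-1, 0, 0, -1), (-1, -1, 1, 0), (0, -1, 1, 1)]

/-- The linear parts of the orientation reversing elements of `Γ`. -/
def reflectionParts : List (ℤ × ℤ × ℤ × ℤ) :=
  [(0, 1, 1, 0), (-1, 0, 1, 1), (-1, -1, 0, 1), (0, -1, -1, 0), (1, 0, -1, -1), (1, 1, 0, -1)]

lemma hasLinearPart_one : HasLinearPart 1 (1, 0, 0, 1) := ⟨0, 0, fun z => by simp⟩

lemma HasLinearPart.eq_one {g : IsomC} {m n : ℤ} (hm : m = 0) (hn : n = 0)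
    (h : ∀ z, coordA (g z) = (1 : ℤ) * coordA z + (0 : ℤ) * coordB z + m ∧
      coordB (g z) = (0 : ℤ) * coordA z + (1 : ℤ) * coordB z + n) : g = 1 := by
  subst hm hn
  ext z
  exact ext_coord (by simp [(h z).1]) (by simp [(h z).2])

lemma HasLinearPart.R6_mul {g : IsomC} {M : ℤ × ℤ × ℤ × ℤ} (h : HasLinearPart g M) :
    HasLinearPart (R6 * g) (M.1 + M.2.2.1, M.2.1 + M.2.2.2, -M.1, -M.2.1) := by
  obtain ⟨m, n, h⟩ := h
  refine ⟨m + n, -m, fun z => ?_⟩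
  rw [IsometryEquiv.mul_apply, coordA_R6, coordB_R6, (h z).1, (h z).2]
  push_cast
  constructor <;> ring

lemma HasLinearPart.R6_inv_mul {g : IsomC} {M : ℤ × ℤ × ℤ × ℤ} (h : HasLinearPart g M) :
    HasLinearPart (R6⁻¹ * g) (-M.2.2.1, -M.2.2.2, M.1 + M.2.2.1, M.2.1 + M.2.2.2) := by
  obtain ⟨m, n, h⟩ := h
  refine ⟨-n, m + n, fun z => ?_⟩
  rw [IsometryEquiv.mul_apply, coordA_R6_inv, coordB_R6_inv, (h z).1, (h z).2]
  push_cast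
  constructor <;> ring

lemma HasLinearPart.R3_mul {g : IsomC} {M : ℤ × ℤ × ℤ × ℤ} (h : HasLinearPart g M) :
    HasLinearPart (R3 * g) (M.2.2.1, M.2.2.2, -M.1 - M.2.2.1, -M.2.1 - M.2.2.2) := by
  obtain ⟨m, n, h⟩ := h
  refine ⟨n, 1 - m - n, fun z => ?_⟩
  rw [IsometryEquiv.mul_apply, coordA_R3, coordB_R3, (h z).1, (h z).2]
  push_cast
  constructor <;> ring

lemma HasLinearPart.R3_inv_mul {g : IsomC} {M : ℤ × ℤ × ℤ × ℤ} (h : HasLinearPart g M) :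
    HasLinearPart (R3⁻¹ * g) (-M.1 - M.2.2.1, -M.2.1 - M.2.2.2, M.1, M.2.1) := by
  obtain ⟨m, n, h⟩ := h
  refine ⟨1 - m - n, m, fun z => ?_⟩
  rw [IsometryEquiv.mul_apply, coordA_R3_inv, coordB_R3_inv, (h z).1, (h z).2]
  push_cast
  constructor <;> ring

lemma HasLinearPart.reflX_mul {g : IsomC} {M : ℤ × ℤ × ℤ × ℤ} (h : HasLinearPart g M) :
    HasLinearPart (reflX * g) (M.2.2.1, M.2.2.2, M.1, M.2.1) := by
  obtain ⟨m, n, h⟩ := h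
  refine ⟨n, m, fun z => ?_⟩
  rw [IsometryEquiv.mul_apply, coordA_reflX, coordB_reflX, (h z).1, (h z).2]
  exact ⟨rfl, rfl⟩

lemma exists_linearPart_of_mem_Γplus {g : IsomC} (hg : g ∈ Γplus) :
    ∃ M ∈ rotationParts, HasLinearPart g M := by
  induction hg using Subgroup.closure_induction_left with
  | one => exact ⟨_, by decide, hasLinearPart_one⟩
  | mul_left x hx y _ ih =>
    obtain ⟨M, hM, h⟩ := ih
    obtain rfl | rfl := hx
    · exact ⟨_, by clear h; revert M; decide, h.R6_mul⟩
    · exact ⟨_, by clear h; revert M; decide, h.R3_mul⟩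
  | inv_mul_cancel x hx y _ ih =>
    obtain ⟨M, hM, h⟩ := ih
    obtain rfl | rfl := hx
    · exact ⟨_, by clear h; revert M; decide, h.R6_inv_mul⟩
    · exact ⟨_, by clear h; revert M; decide, h.R3_inv_mul⟩

lemma exists_linearPart_of_mem_Γfull {g : IsomC} (hg : g ∈ Γfull) :
    ∃ M ∈ rotationParts ++ reflectionParts, HasLinearPart g M := by
  induction hg using Subgroup.closure_induction_left with
  | one => exact ⟨_, by decide, hasLinearPart_one⟩
  | mul_left x hx y _ ih =>
    obtain ⟨M, hM, h⟩ := ih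
    obtain rfl | rfl | rfl := hx
    · exact ⟨_, by clear h; revert M; decide, h.R6_mul⟩
    · exact ⟨_, by clear h; revert M; decide, h.R3_mul⟩
    · exact ⟨_, by clear h; revert M; decide, h.reflX_mul⟩
  | inv_mul_cancel x hx y _ ih =>
    obtain ⟨M, hM, h⟩ := ih
    obtain rfl | rfl | rfl := hx
    · exact ⟨_, by clear h; revert M; decide, h.R6_inv_mul⟩
    · exact ⟨_, by clear h; revert M; decide, h.R3_inv_mul⟩
    · exact ⟨_, by clear h; revert M; decide, reflX_inv ▸ h.reflX_mul⟩

/-! ### Disjointness -/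

/-- The open hexagon around the origin contains no two points differing by a nonzero lattice
vector. -/
lemma eq_zero_of_hexagon {m n : ℤ} (h₁ : |2 * (m : ℝ) + n| < 2) (h₂ : |(m : ℝ) + 2 * n| < 2)
    (h₃ : |(m : ℝ) - n| < 2) : m = 0 ∧ n = 0 := by
  have h₁' : |2 * m + n| < 2 := by exact_mod_cast h₁
  have h₂' : |m + 2 * n| < 2 := by exact_mod_cast h₂
  have h₃' : |m - n| < 2 := by exact_mod_cast h₃
  rw [abs_lt] at h₁' h₂' h₃'
  omega

lemma eq_one_of_mem_interior_Kite {g : IsomC} (hg : g ∈ Γplus) {z : ℂ}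
    (hz : z ∈ interior Kite) (hgz : g z ∈ interior Kite) : g = 1 := by
  obtain ⟨M, hM, m, n, h⟩ := exists_linearPart_of_mem_Γplus hg
  obtain ⟨a₁, a₂, a₃, a₄⟩ := coord_of_mem_interior_Kite hz
  obtain ⟨b₁, b₂, b₃, b₄⟩ := coord_of_mem_interior_Kite hgz
  rw [(h z).1] at b₁ b₃ b₄
  rw [(h z).2] at b₂ b₃ b₄
  have hmn : m = 0 ∧ n = 0 := by
    simp only [rotationParts, List.mem_cons, List.not_mem_nil, or_false] at hM
    apply eq_zero_of_hexagon <;> rw [abs_lt] <;>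
    rcases hM with rfl | rfl | rfl | rfl | rfl | rfl <;> push_cast at b₁ b₂ b₃ b₄ <;>
    constructor <;> linarith
  obtain ⟨rfl, rfl⟩ := hmn
  simp only [rotationParts, List.mem_cons, List.not_mem_nil, or_false] at hM
  rcases hM with rfl | rfl | rfl | rfl | rfl | rfl
  · exact HasLinearPart.eq_one rfl rfl h
  all_goals
    push_cast at b₁ b₂ b₃ b₄
    linarith

lemma eq_one_of_mem_interior_Semikite {g : IsomC} (hg : g ∈ Γfull) {z : ℂ}
    (hz : z ∈ interior Semikite) (hgz : g z ∈ interior Semikite) : g = 1 := by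
  obtain ⟨M, hM, m, n, h⟩ := exists_linearPart_of_mem_Γfull hg
  obtain ⟨a₁, a₂, a₃⟩ := coord_of_mem_interior_Semikite hz
  obtain ⟨b₁, b₂, b₃⟩ := coord_of_mem_interior_Semikite hgz
  rw [(h z).1] at b₂ b₃
  rw [(h z).2] at b₁ b₂ b₃
  have hmn : m = 0 ∧ n = 0 := by
    simp only [rotationParts, reflectionParts, List.cons_append, List.nil_append, List.mem_cons,
      List.not_mem_nil, or_false] at hM
    apply eq_zero_of_hexagon <;> rw [abs_lt] <;>
    rcases hM with rfl | rfl | rfl | rfl | rfl | rfl | rfl | rfl | rfl | rfl | rfl | rfl <;>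
    push_cast at b₁ b₂ b₃ <;> constructor <;> linarith
  obtain ⟨rfl, rfl⟩ := hmn
  simp only [rotationParts, reflectionParts, List.cons_append, List.nil_append, List.mem_cons,
    List.not_mem_nil, or_false] at hM
  rcases hM with rfl | rfl | rfl | rfl | rfl | rfl | rfl | rfl | rfl | rfl | rfl | rfl
  · exact HasLinearPart.eq_one rfl rfl h
  all_goals
    push_cast at b₁ b₂ b₃
    linarith

lemma convex_image_isometryEquiv {K : Set ℂ} (hK : Convex ℝ K) (g : IsomC) :
    Convex ℝ (g '' K) := by
  have h := hK.affine_image g.toRealAffineIsometryEquiv.toAffineEquiv.toAffineMap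
  simpa using h

/-- If no nontrivial element of `G` maps an interior point of the convex set `K` to an interior
point, then the translates of `K` overlap in null sets. -/
lemma volume_image_inter_image_eq_zero {K : Set ℂ} (hK : Convex ℝ K) {G : Subgroup IsomC}
    (hG : ∀ g ∈ G, ∀ z ∈ interior K, g z ∈ interior K → g = 1) :
    ∀ g ∈ G, ∀ h ∈ G, g ≠ h → volume ((g '' K) ∩ (h '' K)) = 0 := by
  intro g hg h hh hne
  refine measure_mono_null (t := frontier (g '' K) ∪ frontier (h '' K)) ?_
    (measure_union_null ((convex_image_isometryEquiv hK g).addHaar_frontier volume)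
      ((convex_image_isometryEquiv hK h).addHaar_frontier volume))
  rintro z ⟨hzg, hzh⟩
  by_contra hz
  rw [Set.mem_union, not_or] at hz
  have interior_of {k : IsomC} (hzk : z ∈ k '' K) (hz' : z ∉ frontier (k '' K)) :
      z ∈ k '' interior K := by
    have : k '' interior K = interior (k '' K) := k.toHomeomorph.image_interior K
    rw [this]
    by_contra hi
    exact hz' ⟨subset_closure hzk, hi⟩
  obtain ⟨x, hx, rfl⟩ := interior_of hzg hz.1
  obtain ⟨y, hy, hxy⟩ := interior_of hzh hz.2
  have hyx : (h⁻¹ * g) x = y := by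
    rw [IsometryEquiv.mul_apply, ← hxy, IsometryEquiv.inv_apply_self]
  have h1 := hG _ (G.mul_mem (G.inv_mem hh) hg) x hx (hyx ▸ hy)
  exact hne (inv_mul_eq_one.1 h1).symm

/-! ### Covering -/

/-- Every point of the plane is a lattice translate of a point of the closed hexagon. -/
lemma exists_translate_mem_hexagon (a b : ℝ) : ∃ m n : ℤ,
    |2 * (a + m) + (b + n)| ≤ 1 ∧ |(a + m) + 2 * (b + n)| ≤ 1 ∧ |(a + m) - (b + n)| ≤ 1 := by
  have a₀ := Int.floor_le a
  have a₁ := Int.lt_floor_add_one a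
  have b₀ := Int.floor_le b
  have b₁ := Int.lt_floor_add_one b
  have hcase : ∃ i j : ℤ, |2 * (a - ⌊a⌋ - i) + (b - ⌊b⌋ - j)| ≤ 1 ∧
      |(a - ⌊a⌋ - i) + 2 * (b - ⌊b⌋ - j)| ≤ 1 ∧ |(a - ⌊a⌋ - i) - (b - ⌊b⌋ - j)| ≤ 1 := by
    set x := a - ⌊a⌋ with hx
    set y := b - ⌊b⌋ with hy
    simp only [abs_le]
    rcases le_total y x with hxy | hxy
    · rcases le_total (x + 2 * y) 2 with h | h
      · rcases le_total (2 * x + y) 1 with h' | h'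
        · exact ⟨0, 0, by push_cast; refine ⟨⟨?_, ?_⟩, ⟨?_, ?_⟩, ?_, ?_⟩ <;> linarith⟩
        · exact ⟨1, 0, by push_cast; refine ⟨⟨?_, ?_⟩, ⟨?_, ?_⟩, ?_, ?_⟩ <;> linarith⟩
      · exact ⟨1, 1, by push_cast; refine ⟨⟨?_, ?_⟩, ⟨?_, ?_⟩, ?_, ?_⟩ <;> linarith⟩
    · rcases le_total (2 * x + y) 2 with h | h
      · rcases le_total (x + 2 * y) 1 with h' | h'
        · exact ⟨0, 0, by push_cast; refine ⟨⟨?_, ?_⟩, ⟨?_, ?_⟩, ?_, ?_⟩ <;> linarith⟩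
        · exact ⟨0, 1, by push_cast; refine ⟨⟨?_, ?_⟩, ⟨?_, ?_⟩, ?_, ?_⟩ <;> linarith⟩
      · exact ⟨1, 1, by push_cast; refine ⟨⟨?_, ?_⟩, ⟨?_, ?_⟩, ?_, ?_⟩ <;> linarith⟩
  obtain ⟨i, j, h⟩ := hcase
  refine ⟨-⌊a⌋ - i, -⌊b⌋ - j, ?_⟩
  push_cast
  convert h using 4 <;> ring

/-- A nonempty set of points, given in lattice coordinates, that is stable under `R6` and under
lattice translations contains a point of the Kite. -/
lemma exists_mem_kite_coord {S : ℝ → ℝ → Prop} (hrot : ∀ a b, S a b → S (a + b) (-a))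
    (hA : ∀ a b, S a b ↔ S (a + 1) b) (hB : ∀ a b, S a b ↔ S a (b + 1)) {a b : ℝ} (h : S a b) :
    ∃ a b, S a b ∧ 0 ≤ a ∧ 0 ≤ b ∧ 2 * a + b ≤ 1 ∧ a + 2 * b ≤ 1 := by
  have hAz (m : ℤ) : ∀ a b, S a b → S (a + m) b := by
    induction m with
    | zero => simp
    | succ i ih =>
      intro a b h
      have := (hA _ _).1 (ih _ _ h)
      push_cast at this ⊢
      rwa [← add_assoc]
    | pred i ih =>
      intro a b h
      refine (hA _ _).2 ?_
      have := ih _ _ h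
      push_cast at this ⊢
      rwa [add_assoc, sub_add_cancel]
  have hBz (m : ℤ) : ∀ a b, S a b → S a (b + m) := by
    induction m with
    | zero => simp
    | succ i ih =>
      intro a b h
      have := (hB _ _).1 (ih _ _ h)
      push_cast at this ⊢
      rwa [← add_assoc]
    | pred i ih =>
      intro a b h
      refine (hB _ _).2 ?_
      have := ih _ _ h
      push_cast at this ⊢
      rwa [add_assoc, sub_add_cancel]
  obtain ⟨m, n, hex⟩ := exists_translate_mem_hexagon a b
  have s₀ := hBz n _ _ (hAz m _ _ h)
  generalize a + (m : ℝ) = x at *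
  generalize b + (n : ℝ) = y at *
  simp only [abs_le] at hex
  obtain ⟨⟨h₁, h₂⟩, ⟨h₃, h₄⟩, h₅, h₆⟩ := hex
  have s₁ := hrot _ _ s₀
  have s₂ := hrot _ _ s₁
  have s₃ := hrot _ _ s₂
  have s₄ := hrot _ _ s₃
  have s₅ := hrot _ _ s₄
  rcases le_total 0 x with hx | hx <;> rcases le_total 0 y with hy | hy <;>
    rcases le_total 0 (x + y) with hxy | hxy <;>
    first
    | exact ⟨_, _, s₀, by linarith, by linarith, by linarith, by linarith⟩
    | exact ⟨_, _, s₁, by linarith, by linarith, by linarith, by linarith⟩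
    | exact ⟨_, _, s₂, by linarith, by linarith, by linarith, by linarith⟩
    | exact ⟨_, _, s₃, by linarith, by linarith, by linarith, by linarith⟩
    | exact ⟨_, _, s₄, by linarith, by linarith, by linarith, by linarith⟩
    | exact ⟨_, _, s₅, by linarith, by linarith, by linarith, by linarith⟩

lemma exists_mem_kite_coord_of_subgroup {G : Subgroup IsomC} (h₆ : R6 ∈ G) (h₃ : R3 ∈ G) (z : ℂ) :
    ∃ g ∈ G, 0 ≤ coordA (g z) ∧ 0 ≤ coordB (g z) ∧ 2 * coordA (g z) + coordB (g z) ≤ 1 ∧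
      coordA (g z) + 2 * coordB (g z) ≤ 1 := by
  let S : ℝ → ℝ → Prop := fun a b => ∃ g ∈ G, coordA (g z) = a ∧ coordB (g z) = b
  have hrot (a b) : S a b → S (a + b) (-a) := by
    rintro ⟨g, hg, rfl, rfl⟩
    exact ⟨R6 * g, G.mul_mem h₆ hg, coordA_R6 _, coordB_R6 _⟩
  have hrot' (a b) : S a b → S (-b) (a + b) := by
    rintro ⟨g, hg, rfl, rfl⟩
    exact ⟨R6⁻¹ * g, G.mul_mem (G.inv_mem h₆) hg, coordA_R6_inv _, coordB_R6_inv _⟩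
  have hthree (a b) : S a b → S b (1 - a - b) := by
    rintro ⟨g, hg, rfl, rfl⟩
    exact ⟨R3 * g, G.mul_mem h₃ hg, coordA_R3 _, coordB_R3 _⟩
  have hthree' (a b) : S a b → S (1 - a - b) a := by
    rintro ⟨g, hg, rfl, rfl⟩
    exact ⟨R3⁻¹ * g, G.mul_mem (G.inv_mem h₃) hg, coordA_R3_inv _, coordB_R3_inv _⟩
  have hB (a b) : S a b ↔ S a (b + 1) := by
    constructor <;> intro h
    · convert hthree _ _ (hrot' _ _ (hrot' _ _ h)) using 1 <;> ring
    · convert hrot _ _ (hrot _ _ (hthree' _ _ h)) using 1 <;> ring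
  have hA (a b) : S a b ↔ S (a + 1) b := by
    constructor <;> intro h
    · convert hrot _ _ ((hB _ _).1 (hrot' _ _ h)) using 1 <;> ring
    · have := hrot' _ _ h
      rw [show a + 1 + b = a + b + 1 by ring, ← hB] at this
      convert hrot _ _ this using 1 <;> ring
  obtain ⟨a, b, ⟨g, hg, rfl, rfl⟩, h⟩ :=
    exists_mem_kite_coord hrot hA hB (S := S) ⟨1, G.one_mem, rfl, rfl⟩
  exact ⟨g, hg, h⟩

lemma volume_compl_iUnion_image_eq_zero {G : Subgroup IsomC} {K : Set ℂ}
    (h : ∀ z, ∃ g ∈ G, g z ∈ K) : volume (⋃ g ∈ (G : Set IsomC), g '' K)ᶜ = 0 := by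
  have : ⋃ g ∈ (G : Set IsomC), g '' K = Set.univ := by
    refine Set.eq_univ_of_forall fun z => ?_
    obtain ⟨g, hg, hz⟩ := h z
    exact Set.mem_biUnion (G.inv_mem hg) ⟨g z, hz, IsometryEquiv.inv_apply_self g z⟩
  rw [this, Set.compl_univ, measure_empty]

lemma exists_mem_Kite (z : ℂ) : ∃ g ∈ Γplus, g z ∈ Kite := by
  obtain ⟨g, hg, h₁, h₂, h₃, h₄⟩ := exists_mem_kite_coord_of_subgroup (G := Γplus)
    (Subgroup.subset_closure (by simp)) (Subgroup.subset_closure (by simp)) z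
  exact ⟨g, hg, mem_Kite_of_coord h₁ h₂ h₃ h₄⟩

lemma exists_mem_Semikite (z : ℂ) : ∃ g ∈ Γfull, g z ∈ Semikite := by
  obtain ⟨g, hg, h₁, h₂, h₃, h₄⟩ := exists_mem_kite_coord_of_subgroup (G := Γfull)
    (Subgroup.subset_closure (by simp)) (Subgroup.subset_closure (by simp)) z
  rcases le_total (coordB (g z)) (coordA (g z)) with h | h
  · exact ⟨g, hg, mem_Semikite_of_coord h₂ h h₃⟩
  · refine ⟨reflX * g, Γfull.mul_mem (Subgroup.subset_closure (by simp)) hg, ?_⟩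
    rw [IsometryEquiv.mul_apply]
    apply mem_Semikite_of_coord <;> simp only [coordA_reflX, coordB_reflX] <;> linarith

theorem statement_18 :
    -- (i) the Kite is a fundamental domain for `Γ⁺` up to Lebesgue-null sets:
    ((∀ g ∈ Γplus, ∀ h ∈ Γplus, g ≠ h → volume ((g '' Kite) ∩ (h '' Kite)) = 0) ∧
      volume ((⋃ g ∈ (Γplus : Set IsomC), g '' Kite)ᶜ) = 0) ∧
    -- (ii) the Semikite is a fundamental domain for `Γ` up to Lebesgue-null sets:
    ((∀ g ∈ Γfull, ∀ h ∈ Γfull, g ≠ h →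
        volume ((g '' Semikite) ∩ (h '' Semikite)) = 0) ∧
      volume ((⋃ g ∈ (Γfull : Set IsomC), g '' Semikite)ᶜ) = 0) := by
  exact ⟨⟨volume_image_inter_image_eq_zero (convex_convexHull ℝ _)
      fun _ hg _ => eq_one_of_mem_interior_Kite hg,
    volume_compl_iUnion_image_eq_zero exists_mem_Kite⟩,
    volume_image_inter_image_eq_zero (convex_convexHull ℝ _)
      fun _ hg _ => eq_one_of_mem_interior_Semikite hg,
    volume_compl_iUnion_image_eq_zero exists_mem_Semikite⟩

end
end
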